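/- For any s ∈ (0,1), the identity ∫₀¹ ((1+t)^s + (1-t)^s − 2)/t^{1+2s} dt + ∫₁^∞ (1+t)^s/t^{1+2s} dt = 1/s holds. -/

import Mathlib

open MeasureTheory

open Set Filter Topology

namespace FractionalBeta

/-- The integrand `(1 + t) ^ s / t ^ (1 + 2 s)` of the tail integral. -/
noncomputable def kernel (s t : ℝ) : ℝ := (1 + t) ^ s / t ^ (1 + 2 * s)

/-- The primitive of `kernel s` on the positive half-line that vanishes at `1`. -/
noncomputable def primitive (s t : ℝ) : ℝ := ∫ u in (1 : ℝ)..t, kernel s u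

/-- A primitive on `(0, 1)` of the integrand of the first integral. -/
noncomputable def fullPrimitive (s t : ℝ) : ℝ :=
  primitive s t - primitive s (t / (1 - t)) + 1 / s * (t ^ (-(2 * s)) * (1 - (1 - t) ^ s))

lemma continuousOn_kernel (s : ℝ) : ContinuousOn (kernel s) (Ioi 0) := by
  intro t ht
  have ht : 0 < t := ht
  apply ContinuousAt.continuousWithinAt
  unfold kernel
  exact ((continuousAt_const.add continuousAt_id).rpow_const (Or.inl (by simp; linarith))).div
    (continuousAt_id.rpow_const (Or.inl ht.ne')) (Real.rpow_pos_of_pos ht _).ne'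

lemma intervalIntegrable_kernel (s : ℝ) {a b : ℝ} (ha : 0 < a) (hb : 0 < b) :
    IntervalIntegrable (kernel s) volume a b :=
  ((continuousOn_kernel s).mono fun _ hx => (lt_min ha hb).trans_le hx.1).intervalIntegrable

lemma hasDerivAt_primitive (s : ℝ) {t : ℝ} (ht : 0 < t) :
    HasDerivAt (primitive s) (kernel s t) t :=
  intervalIntegral.integral_hasDerivAt_right (intervalIntegrable_kernel s one_pos ht)
    ((continuousOn_kernel s).stronglyMeasurableAtFilter isOpen_Ioi t ht)
    ((continuousOn_kernel s).continuousAt (Ioi_mem_nhds ht))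

lemma one_add_rpow_bounds {s u : ℝ} (hs0 : 0 < s) (hs1 : s < 1) (hu : 0 < u) :
    1 ≤ (1 + u) ^ s ∧ (1 + u) ^ s ≤ 1 + s * u :=
  ⟨Real.one_le_rpow (by linarith) hs0.le,
    rpow_one_add_le_one_add_mul_self (by linarith) hs0.le hs1.le⟩

lemma integrableOn_kernel {s : ℝ} (hs0 : 0 < s) :
    IntegrableOn (kernel s) (Ioi 1) := by
  have h := (integrableOn_Ioi_rpow_of_lt (a := -1 - s) (by linarith) one_pos).const_mul (2 ^ s)
  refine h.mono' ((continuousOn_kernel s).mono (Ioi_subset_Ioi zero_le_one)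
    |>.aestronglyMeasurable measurableSet_Ioi) ?_
  filter_upwards [ae_restrict_mem measurableSet_Ioi] with t ht
  have ht : 1 < t := ht
  have ht0 : 0 < t := by linarith
  have hn : 0 ≤ kernel s t := by unfold kernel; positivity
  rw [Real.norm_of_nonneg hn, kernel, div_le_iff₀ (by positivity), mul_assoc,
    ← Real.rpow_add ht0, show -1 - s + (1 + 2 * s) = s by ring,
    ← Real.mul_rpow (by norm_num) ht0.le]
  exact Real.rpow_le_rpow (by linarith) (by linarith) hs0.le

lemma kernel_div_one_sub {s t : ℝ} (h0 : 0 < t) (h1 : t < 1) :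
    kernel s (t / (1 - t)) = (1 - t) ^ s * (1 - t) / t ^ (1 + 2 * s) := by
  have h : 0 < 1 - t := by linarith
  have e : 1 + t / (1 - t) = (1 - t)⁻¹ := by field_simp; ring
  rw [kernel, e, Real.div_rpow h0.le h.le, Real.inv_rpow h.le,
    show 1 + 2 * s = 1 + (s + s) by ring, Real.rpow_add h, Real.rpow_add h, Real.rpow_one]
  have := Real.rpow_pos_of_pos h s
  have := Real.rpow_pos_of_pos h0 (1 + (s + s))
  field_simp

lemma hasDerivAt_fullPrimitive {s t : ℝ} (hs0 : 0 < s) (h0 : 0 < t) (h1 : t < 1) :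
    HasDerivAt (fullPrimitive s) (((1 + t) ^ s + (1 - t) ^ s - 2) / t ^ (1 + 2 * s)) t := by
  have h : 0 < 1 - t := by linarith
  have dsub : HasDerivAt (fun x : ℝ => 1 - x) (-1) t := by
    simpa using (hasDerivAt_id t).const_sub 1
  have dw := (hasDerivAt_id t).div dsub h.ne'
  have d1 := (hasDerivAt_primitive s h0)
  have d2 := (hasDerivAt_primitive s (div_pos h0 h)).comp t dw
  have d3 := Real.hasDerivAt_rpow_const (x := t) (p := -(2 * s)) (Or.inl h0.ne')
  have d4 := (dsub.rpow_const (p := s) (Or.inl h.ne')).const_sub 1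
  refine ((d1.sub d2).add ((d3.mul d4).const_mul (1 / s))).congr_deriv ?_
  rw [kernel_div_one_sub h0 h1, kernel, Real.rpow_sub_one h.ne', Real.rpow_sub_one h0.ne',
    Real.rpow_neg h0.le, Real.rpow_add h0, Real.rpow_one]
  have := Real.rpow_pos_of_pos h0 (2 * s)
  simp only [id]
  field_simp
  ring

lemma integrand_bounds {s t : ℝ} (hs0 : 0 < s) (hs1 : s < 1) (h0 : 0 < t) (h1 : t < 1) :
    |(1 + t) ^ s + (1 - t) ^ s - 2| ≤ 2 * t ^ 2 := by
  have ha := (one_add_rpow_bounds hs0 hs1 h0).2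
  have hb : (1 - t) ^ s ≤ 1 + s * (-t) := by
    simpa [sub_eq_add_neg] using
      rpow_one_add_le_one_add_mul_self (s := -t) (by linarith) hs0.le hs1.le
  have hp : 1 - t ^ 2 ≤ (1 + t) ^ s * (1 - t) ^ s := by
    rw [← Real.mul_rpow (by linarith) (by linarith), show (1 + t) * (1 - t) = 1 - t ^ 2 by ring]
    exact Real.self_le_rpow_of_le_one (by nlinarith) (by nlinarith) hs1.le
  have hap : 0 < (1 + t) ^ s := Real.rpow_pos_of_pos (by linarith) s
  have hbp : 0 < (1 - t) ^ s := Real.rpow_pos_of_pos (by linarith) s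
  have hlow : 2 * (1 - t ^ 2) ≤ (1 + t) ^ s + (1 - t) ^ s := by
    apply le_of_sq_le_sq _ (by linarith)
    nlinarith [sq_nonneg ((1 + t) ^ s - (1 - t) ^ s), mul_pos h0 h0,
      mul_nonneg (sq_nonneg t) (show 0 ≤ 1 - t ^ 2 by nlinarith)]
  rw [abs_le]
  constructor <;> nlinarith

lemma intervalIntegrable_integrand {s : ℝ} (hs0 : 0 < s) (hs1 : s < 1) :
    IntervalIntegrable (fun t : ℝ => ((1 + t) ^ s + (1 - t) ^ s - 2) / t ^ (1 + 2 * s))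
      volume 0 1 := by
  have h := (intervalIntegral.intervalIntegrable_rpow' (a := 0) (b := 1) (r := 1 - 2 * s)
    (by linarith)).const_mul 2
  rw [intervalIntegrable_iff_integrableOn_Ioo_of_le zero_le_one] at h ⊢
  refine h.mono' (Measurable.aestronglyMeasurable (by fun_prop)) ?_
  filter_upwards [ae_restrict_mem measurableSet_Ioo] with t ht
  have ht0 := ht.1
  have e : t ^ (1 - 2 * s) * t ^ (1 + 2 * s) = t ^ 2 := by
    rw [← Real.rpow_add ht0, ← Real.rpow_natCast]; congr 1; norm_num
  rw [norm_div, Real.norm_eq_abs, Real.norm_of_nonneg (by positivity),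
    div_le_iff₀ (by positivity), mul_assoc, e]
  exact integrand_bounds hs0 hs1 ht.1 ht.2

lemma tendsto_fullPrimitive_one {s : ℝ} (hs0 : 0 < s) :
    Tendsto (fullPrimitive s) (𝓝[<] 1) (𝓝 (1 / s - ∫ t in Ioi (1 : ℝ), kernel s t)) := by
  have hw : Tendsto (fun t : ℝ => t / (1 - t)) (𝓝[<] 1) atTop := by
    have h1 : Tendsto (fun t : ℝ => 1 - t) (𝓝[<] 1) (𝓝[>] 0) := by
      refine tendsto_nhdsWithin_iff.2 ⟨?_, ?_⟩
      · have : Tendsto (fun t : ℝ => 1 - t) (𝓝 1) (𝓝 (1 - 1)) :=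
          (by fun_prop : Continuous fun t : ℝ => 1 - t).tendsto 1
        simpa using this.mono_left nhdsWithin_le_nhds
      · filter_upwards [self_mem_nhdsWithin] with t ht
        exact sub_pos.2 (mem_Iio.1 ht)
    simp only [div_eq_mul_inv]
    exact (tendsto_id.mono_left nhdsWithin_le_nhds).pos_mul_atTop one_pos
      (tendsto_inv_nhdsGT_zero.comp h1)
  have hP : Tendsto (fun t => primitive s (t / (1 - t))) (𝓝[<] 1)
      (𝓝 (∫ t in Ioi (1 : ℝ), kernel s t)) :=
    intervalIntegral_tendsto_integral_Ioi 1 (integrableOn_kernel hs0) hw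
  have h1 : Tendsto (primitive s) (𝓝[<] 1) (𝓝 0) := by
    have := (hasDerivAt_primitive s one_pos).continuousAt.tendsto
    simp only [primitive, intervalIntegral.integral_same] at this
    exact this.mono_left nhdsWithin_le_nhds
  have h2 : Tendsto (fun t : ℝ => 1 / s * (t ^ (-(2 * s)) * (1 - (1 - t) ^ s))) (𝓝[<] 1)
      (𝓝 (1 / s)) := by
    have hc : ContinuousAt (fun t : ℝ => 1 / s * (t ^ (-(2 * s)) * (1 - (1 - t) ^ s))) 1 := by
      refine continuousAt_const.mul ((continuousAt_id.rpow_const (Or.inl one_ne_zero)).mul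
        (continuousAt_const.sub ?_))
      exact (continuousAt_const.sub continuousAt_id).rpow_const (Or.inr hs0.le)
    have := hc.tendsto
    simp only [sub_self, Real.zero_rpow hs0.ne', Real.one_rpow, sub_zero, mul_one] at this
    exact this.mono_left nhdsWithin_le_nhds
  have h3 := (h1.sub hP).add h2
  rwa [zero_sub, neg_add_eq_sub] at h3

lemma abs_fullPrimitive_le {s t : ℝ} (hs0 : 0 < s) (hs1 : s < 1) (h0 : 0 < t) (h1 : t < 1 / 2) :
    |fullPrimitive s t| ≤ (1 / (2 * s) + 2 * s) * t ^ (2 - 2 * s) := by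
  have h : 0 < 1 - t := by linarith
  set w := t / (1 - t) with hwdef
  have htw : t ≤ w := by rw [hwdef, le_div_iff₀ h]; nlinarith
  have hw0 : 0 < w := h0.trans_le htw
  have hwt : w - t ≤ 2 * t ^ 2 := by
    have : w - t = t ^ 2 / (1 - t) := by rw [hwdef]; field_simp; ring
    rw [this, div_le_iff₀ h]; nlinarith [sq_nonneg t]
  have hnot : (0 : ℝ) ∉ uIcc t w := fun hx => absurd hx.1 (by simp [h0, hw0])
  have hdiff : primitive s w - primitive s t = ∫ u in t..w, kernel s u :=
    intervalIntegral.integral_interval_sub_left (intervalIntegrable_kernel s one_pos hw0)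
      (intervalIntegrable_kernel s one_pos h0)
  have hpow : IntervalIntegrable (fun u : ℝ => u ^ (-1 - 2 * s)) volume t w :=
    intervalIntegral.intervalIntegrable_rpow (Or.inr hnot)
  have hrpow : ∫ u in t..w, u ^ (-1 - 2 * s) = (t ^ (-(2 * s)) - w ^ (-(2 * s))) / (2 * s) := by
    rw [integral_rpow (Or.inr ⟨by linarith, hnot⟩), show -1 - 2 * s + 1 = -(2 * s) by ring]
    field_simp
    ring
  have hker : ∀ u, 0 < u → kernel s u = (1 + u) ^ s * u ^ (-1 - 2 * s) := fun u hu => by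
    rw [kernel, show -1 - 2 * s = -(1 + 2 * s) by ring, Real.rpow_neg hu.le, div_eq_mul_inv]
  have hlow : (t ^ (-(2 * s)) - w ^ (-(2 * s))) / (2 * s) ≤ ∫ u in t..w, kernel s u := by
    rw [← hrpow]
    refine intervalIntegral.integral_mono_on htw hpow (intervalIntegrable_kernel s h0 hw0) ?_
    intro u hu
    have hu0 := h0.trans_le hu.1
    rw [hker u hu0]
    exact le_mul_of_one_le_left (by positivity) (one_add_rpow_bounds hs0 hs1 hu0).1
  have hup : ∫ u in t..w, kernel s u ≤
      (t ^ (-(2 * s)) - w ^ (-(2 * s))) / (2 * s) + (w - t) * (s * t ^ (-(2 * s))) := by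
    rw [← hrpow, ← smul_eq_mul (w - t), ← intervalIntegral.integral_const,
      ← intervalIntegral.integral_add hpow intervalIntegrable_const]
    refine intervalIntegral.integral_mono_on htw (intervalIntegrable_kernel s h0 hw0)
      (hpow.add intervalIntegrable_const) ?_
    intro u hu
    have hu0 := h0.trans_le hu.1
    have e : u * u ^ (-1 - 2 * s) = u ^ (-(2 * s)) := by
      rw [← Real.rpow_one_add' hu0.le (by linarith)]; congr 1; ring
    have hmono : u ^ (-(2 * s)) ≤ t ^ (-(2 * s)) :=
      Real.rpow_le_rpow_of_nonpos h0 hu.1 (by linarith)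
    have hpos : 0 < u ^ (-1 - 2 * s) := by positivity
    rw [hker u hu0]
    calc (1 + u) ^ s * u ^ (-1 - 2 * s) ≤ (1 + s * u) * u ^ (-1 - 2 * s) :=
          mul_le_mul_of_nonneg_right (one_add_rpow_bounds hs0 hs1 hu0).2 hpos.le
      _ = u ^ (-1 - 2 * s) + s * u ^ (-(2 * s)) := by rw [← e]; ring
      _ ≤ _ := by gcongr
  have hwp : w ^ (-(2 * s)) = t ^ (-(2 * s)) * ((1 - t) ^ s) ^ 2 := by
    rw [hwdef, Real.div_rpow h0.le h.le, Real.rpow_neg h.le, div_inv_eq_mul, mul_comm 2 s,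
      Real.rpow_mul h.le, Real.rpow_two]
  have hfull : fullPrimitive s t = -(∫ u in t..w, kernel s u) +
      (t ^ (-(2 * s)) - w ^ (-(2 * s))) / (2 * s) +
        t ^ (-(2 * s)) * (1 - (1 - t) ^ s) ^ 2 / (2 * s) := by
    rw [fullPrimitive, ← hwdef, ← hdiff, hwp]
    field_simp
    ring
  have hE : t ^ (2 - 2 * s) = t ^ (-(2 * s)) * t ^ 2 := by
    rw [← Real.rpow_two, ← Real.rpow_add h0]; congr 1; ring
  have hT : 0 < t ^ (-(2 * s)) := by positivity
  have hge : 1 - t ≤ (1 - t) ^ s := Real.self_le_rpow_of_le_one h.le (by linarith) hs1.le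
  have hle : (1 - t) ^ s ≤ 1 := Real.rpow_le_one h.le (by linarith) hs0.le
  have hsq : (1 - (1 - t) ^ s) ^ 2 ≤ t ^ 2 := by
    apply pow_le_pow_left₀ <;> linarith
  have hA : t ^ (-(2 * s)) * (1 - (1 - t) ^ s) ^ 2 / (2 * s) ≤ 1 / (2 * s) * t ^ (2 - 2 * s) := by
    rw [hE, div_mul_eq_mul_div, one_mul]
    gcongr
  have hA0 : 0 ≤ t ^ (-(2 * s)) * (1 - (1 - t) ^ s) ^ 2 / (2 * s) := by positivity
  have hB : (w - t) * (s * t ^ (-(2 * s))) ≤ 2 * s * t ^ (2 - 2 * s) := by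
    rw [hE]
    nlinarith [mul_le_mul_of_nonneg_right hwt (mul_pos hs0 hT).le]
  have hB0 : 0 ≤ 2 * s * t ^ (2 - 2 * s) := by positivity
  rw [hfull, abs_le]
  constructor <;> linarith

lemma tendsto_fullPrimitive_zero {s : ℝ} (hs0 : 0 < s) (hs1 : s < 1) :
    Tendsto (fullPrimitive s) (𝓝[>] 0) (𝓝 0) := by
  have hb : Tendsto (fun t : ℝ => (1 / (2 * s) + 2 * s) * t ^ (2 - 2 * s)) (𝓝[>] 0) (𝓝 0) := by
    have hc : ContinuousAt (fun t : ℝ => (1 / (2 * s) + 2 * s) * t ^ (2 - 2 * s)) 0 :=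
      continuousAt_const.mul (continuousAt_id.rpow_const (Or.inr (by linarith)))
    have := hc.tendsto
    rw [Real.zero_rpow (by linarith), mul_zero] at this
    exact this.mono_left nhdsWithin_le_nhds
  refine squeeze_zero_norm' ?_ hb
  filter_upwards [Ioo_mem_nhdsGT (show (0 : ℝ) < 1 / 2 by norm_num)] with t ht
  exact abs_fullPrimitive_le hs0 hs1 ht.1 ht.2

end FractionalBeta

open FractionalBeta in
theorem stmt_0 (s : ℝ) (hs0 : 0 < s) (hs1 : s < 1) :
    (∫ t in Set.Ioo (0:ℝ) 1, ((1 + t) ^ s + (1 - t) ^ s - 2) / t ^ (1 + 2 * s)) +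
      (∫ t in Set.Ioi (1:ℝ), (1 + t) ^ s / t ^ (1 + 2 * s)) = 1 / s := by
  have h := intervalIntegral.integral_eq_sub_of_hasDerivAt_of_tendsto zero_lt_one
    (fun t ht => hasDerivAt_fullPrimitive hs0 ht.1 ht.2) (intervalIntegrable_integrand hs0 hs1)
    (tendsto_fullPrimitive_zero hs0 hs1) (tendsto_fullPrimitive_one hs0)
  rw [intervalIntegral.integral_of_le zero_le_one, integral_Ioc_eq_integral_Ioo] at h
  rw [h]
  simp only [kernel]
  ring
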